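/- Let α be irrational, and let f : ℝ → ℝ be a 1-periodic function with Var f < ∞. Then for Lebesgue-almost every x ∈ [0,1), no real number E with 0 < L(E) < β(α) is an eigenvalue of the operator H(x); that is, there is no nonzero ℓ²(ℤ) solution ψ of ψ(n+1) + ψ(n−1) + f(x+nα)ψ(n) = Eψ(n). -/

import Mathlib

open MeasureTheory Filter
open scoped ENNReal NNReal

noncomputable section

attribute [local instance] Matrix.linftyOpNormedRing

/-- The truncation `[f]_B` of a real-valued function: `[f]_B x = f x` if `|f x| ≤ B`,
and `B` otherwise. -/
def trunc (f : ℝ → ℝ) (B : ℝ) : ℝ → ℝ := fun x => if |f x| ≤ B then f x else B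

/-- The total variation of a `1`-periodic function over the period `[0,1]`. -/
def pVar (f : ℝ → ℝ) : ℝ≥0∞ := eVariationOn f (Set.Icc 0 1)

/-- The semi-bounded variation `𝒱(f) = sup_{B ≥ 1} (1/B) Var [f]_B`. -/
def sVar (f : ℝ → ℝ) : ℝ≥0∞ :=
  ⨆ B : {B : ℝ // 1 ≤ B}, (ENNReal.ofReal B.1)⁻¹ * pVar (trunc f B.1)

/-- Iterates of the Gauss map, starting from the fractional part of `α`. -/
def gaussIter (α : ℝ) : ℕ → ℝ
  | 0 => Int.fract α
  | (k+1) => Int.fract (gaussIter α k)⁻¹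

/-- The continued fraction digit `a_{k+1}` of `α`. -/
def cfA (α : ℝ) (k : ℕ) : ℕ := ⌊(gaussIter α k)⁻¹⌋₊

/-- The denominators `q_k` of the continued fraction approximants of `α`:
`q₀ = 1`, `q₁ = a₁`, `q_{k+1} = a_{k+1} q_k + q_{k-1}`. -/
def cfDen (α : ℝ) : ℕ → ℕ
  | 0 => 1
  | 1 => cfA α 0
  | (k+2) => cfA α (k+1) * cfDen α (k+1) + cfDen α k

/-- The exponential rate of approximation `β(α) = limsup_k (log q_{k+1})/q_k ∈ [0,∞]`. -/
def cfBeta (α : ℝ) : EReal :=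
  Filter.limsup (fun k : ℕ => ((Real.log (cfDen α (k+1)) / (cfDen α k) : ℝ) : EReal))
    Filter.atTop

/-- The `n`-step transfer matrix `S_n^{f,E}(x) = S^{f,E}(x+(n-1)α) ⋯ S^{f,E}(x)` of the
quasiperiodic Schrödinger cocycle, where `S^{f,E}(y) = [[E - f y, -1], [1, 0]]`. -/
def schCocycle (α : ℝ) (f : ℝ → ℝ) (E : ℝ) (n : ℕ) (x : ℝ) :
    Matrix (Fin 2) (Fin 2) ℂ :=
  ((List.range n).map fun k =>
    !![((E : ℂ) - (f (x + ((n - 1 - k : ℕ) : ℝ) * α) : ℂ)), -1; 1, 0]).prod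


/-- A periodic function of bounded variation is dominated by a monotone function. -/
theorem exists_dom (f : ℝ → ℝ) (hper : Function.Periodic f 1) (hBV : pVar f ≠ ⊤) :
    ∃ (V : ℝ → ℝ) (c : ℝ), (∀ y z, y ≤ z → |f y - f z| ≤ V z - V y) ∧
      ∀ y, V (y + 1) = V y + c := by
  have hb : BoundedVariationOn f (Set.Icc 0 1) := hBV
  have hl := hb.locallyBoundedVariationOn
  set W : ℝ → ℝ → ℝ := variationOnFromTo f (Set.Icc 0 1) with hW
  have key : ∀ s ∈ Set.Icc (0:ℝ) 1, ∀ t ∈ Set.Icc (0:ℝ) 1, s ≤ t → |f s - f t| ≤ W 0 t - W 0 s := by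
    intro s hs t ht hst
    have h1 : W 0 s + W s t = W 0 t :=
      variationOnFromTo.add hl (by simp) hs ht
    have h2 : W s t = (eVariationOn f (Set.Icc 0 1 ∩ Set.Icc s t)).toReal :=
      variationOnFromTo.eq_of_le f _ hst
    have h3 : edist (f s) (f t) ≤ eVariationOn f (Set.Icc 0 1 ∩ Set.Icc s t) :=
      eVariationOn.edist_le f ⟨hs, le_refl _, hst⟩ ⟨ht, hst, le_refl _⟩
    have h4 := ENNReal.toReal_mono (hl s t hs ht) h3
    rw [edist_dist, ENNReal.toReal_ofReal dist_nonneg, Real.dist_eq, ← h2] at h4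
    linarith
  have hfr : ∀ y, f y = f (Int.fract y) := by
    intro y
    have := hper.sub_zsmul_eq (x := y) ⌊y⌋
    rw [Int.fract]; simpa using this.symm
  have hfm : ∀ y : ℝ, Int.fract y ∈ Set.Icc (0:ℝ) 1 := fun y =>
    ⟨Int.fract_nonneg y, (Int.fract_lt_one y).le⟩
  have h0m : (0:ℝ) ∈ Set.Icc (0:ℝ) 1 := by simp
  have h1m : (1:ℝ) ∈ Set.Icc (0:ℝ) 1 := by simp
  have hW0 : W 0 0 = 0 := variationOnFromTo.self f _ 0
  refine ⟨fun y => ⌊y⌋ * W 0 1 + W 0 (Int.fract y), W 0 1, ?_, ?_⟩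
  · intro y z hyz
    have hfl : ⌊y⌋ ≤ ⌊z⌋ := Int.floor_mono hyz
    rw [hfr y, hfr z]
    rcases hfl.eq_or_lt with h | h
    · have : Int.fract y ≤ Int.fract z := by
        unfold Int.fract; rw [h]; linarith
      have := key _ (hfm y) _ (hfm z) this
      simp only [h]; linarith
    · have hc : 0 ≤ W 0 1 := by
        have := key 0 h0m 1 h1m zero_le_one
        linarith [abs_nonneg (f 0 - f 1)]
      have e1 := key _ (hfm y) 1 h1m (hfm y).2
      have e2 := key 0 h0m _ (hfm z) (hfm z).1
      have e3 : f 1 = f 0 := by simpa using hper 0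
      have e4 : ((⌊y⌋:ℝ) + 1) ≤ ⌊z⌋ := by exact_mod_cast h
      have e5 : ((⌊y⌋:ℝ) + 1) * W 0 1 ≤ ⌊z⌋ * W 0 1 := mul_le_mul_of_nonneg_right e4 hc
      have e6 := abs_sub_le (f (Int.fract y)) (f 0) (f (Int.fract z))
      rw [e3] at e1
      simp only
      linarith
  · intro y
    simp only [Int.floor_add_one, Int.fract_add_one]
    push_cast; ring

theorem gauss_irr (α : ℝ) (hα : Irrational α) (k : ℕ) : Irrational (gaussIter α k) := by
  induction k with
  | zero =>
    rw [gaussIter, Int.fract]; exact hα.sub_intCast _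
  | succ k ih =>
    rw [gaussIter, Int.fract]; exact ih.inv.sub_intCast _

theorem gauss_pos (α : ℝ) (hα : Irrational α) (k : ℕ) : 0 < gaussIter α k := by
  have h0 : 0 ≤ gaussIter α k := by
    cases k <;> exact Int.fract_nonneg _
  exact lt_of_le_of_ne h0 (gauss_irr α hα k).ne_zero.symm

theorem gauss_lt_one (α : ℝ) (k : ℕ) : gaussIter α k < 1 := by
  cases k <;> exact Int.fract_lt_one _

theorem gauss_succ (α : ℝ) (hα : Irrational α) (k : ℕ) :
    gaussIter α (k+1) = (gaussIter α k)⁻¹ - cfA α k := by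
  have := gauss_pos α hα k
  rw [gaussIter, Int.fract, cfA]
  congr 1
  exact_mod_cast (natCast_floor_eq_intCast_floor (inv_nonneg.2 this.le)).symm

theorem one_le_cfA (α : ℝ) (hα : Irrational α) (k : ℕ) : 1 ≤ cfA α k := by
  have := gauss_pos α hα k
  rw [cfA, Nat.one_le_floor_iff]
  exact (one_le_inv₀ this).2 (gauss_lt_one α k).le

/-- Numerators of the approximants. -/
def cfNum (α : ℝ) : ℕ → ℤ
  | 0 => ⌊α⌋
  | 1 => cfA α 0 * ⌊α⌋ + 1
  | (k+2) => cfA α (k+1) * cfNum α (k+1) + cfNum α k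

theorem one_le_cfDen (α : ℝ) (hα : Irrational α) (k : ℕ) : 1 ≤ cfDen α k := by
  induction k using Nat.twoStepInduction with
  | zero => simp [cfDen]
  | one => simpa [cfDen] using one_le_cfA α hα 0
  | more k h1 h2 => rw [cfDen]; omega

theorem cfDen_mono (α : ℝ) (hα : Irrational α) (k : ℕ) : cfDen α k ≤ cfDen α (k+1) := by
  cases k with
  | zero => simpa [cfDen] using one_le_cfA α hα 0
  | succ k =>
    rw [cfDen]
    have := Nat.mul_le_mul_right (cfDen α (k+1)) (one_le_cfA α hα (k+1))
    omega

theorem le_cfDen (α : ℝ) (hα : Irrational α) (k : ℕ) : k ≤ cfDen α k := by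
  induction k using Nat.twoStepInduction with
  | zero => simp
  | one => simpa [cfDen] using one_le_cfA α hα 0
  | more k h1 h2 =>
    rw [cfDen]
    have := Nat.mul_le_mul_right (cfDen α (k+1)) (one_le_cfA α hα (k+1))
    have := one_le_cfDen α hα k
    omega

theorem cf_D_succ (α : ℝ) (hα : Irrational α) (k : ℕ) :
    cfDen α (k+1) * α - cfNum α (k+1) = - gaussIter α (k+1) * (cfDen α k * α - cfNum α k) := by
  induction k with
  | zero =>
    have h := gauss_succ α hα 0
    have hp := gauss_pos α hα 0
    rw [h]
    have e : gaussIter α 0 = α - ⌊α⌋ := by rw [gaussIter, Int.fract]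
    simp only [cfDen, cfNum]
    push_cast
    rw [one_mul, ← e, neg_mul, sub_mul, inv_mul_cancel₀ hp.ne', e]; ring
  | succ k ih =>
    have h := gauss_succ α hα (k+1)
    have hp := gauss_pos α hα (k+1)
    have e : (cfDen α k * α - cfNum α k) =
        - (gaussIter α (k+1))⁻¹ * (cfDen α (k+1) * α - cfNum α (k+1)) := by
      rw [ih]; field_simp
    rw [h]
    have e2 : cfDen α (k+1+1) * α - cfNum α (k+1+1) =
      cfA α (k+1) * (cfDen α (k+1) * α - cfNum α (k+1)) + (cfDen α k * α - cfNum α k) := by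
      simp only [cfDen, cfNum]; push_cast; ring
    rw [e2, e]; ring

theorem cf_det (α : ℝ) (k : ℕ) :
    cfDen α k * cfNum α (k+1) - cfDen α (k+1) * cfNum α k = (-1) ^ k := by
  induction k with
  | zero => simp [cfDen, cfNum]
  | succ k ih =>
    simp only [cfDen, cfNum]
    push_cast
    rw [pow_succ, ← ih]; ring

theorem cf_abs (α : ℝ) (hα : Irrational α) (k : ℕ) :
    |cfDen α k * α - cfNum α k| ≤ 1 / cfDen α (k+1) := by
  have h1 := cf_D_succ α hα k
  have h2 : (cfDen α k * cfNum α (k+1) - cfDen α (k+1) * cfNum α k : ℝ) = (-1) ^ k := by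
    exact_mod_cast cf_det α k
  have hg := gauss_pos α hα (k+1)
  have hq : (0:ℝ) < cfDen α (k+1) := by exact_mod_cast one_le_cfDen α hα (k+1)
  set D := cfDen α k * α - cfNum α k
  have h3 : D * (cfDen α (k+1) + cfDen α k * gaussIter α (k+1)) = (-1)^k := by
    have : (cfDen α (k+1) : ℝ) * D - cfDen α k * (cfDen α (k+1) * α - cfNum α (k+1)) = (-1)^k := by
      rw [← h2]; simp only [D]; ring
    rw [h1] at this; linarith
  have h4 := congrArg abs h3
  have hpos : (0:ℝ) < cfDen α (k+1) + cfDen α k * gaussIter α (k+1) := by positivity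
  rw [abs_mul, abs_pow, abs_neg, abs_one, one_pow, abs_of_pos hpos] at h4
  rw [le_div_iff₀ hq, ← h4]
  gcongr
  have : 0 ≤ cfDen α k * gaussIter α (k+1) := by positivity
  linarith

theorem cf_coprime (α : ℝ) (k : ℕ) : IsCoprime (cfNum α k) (cfDen α k : ℤ) := by
  refine ⟨-(-1)^k * cfDen α (k+1), (-1)^k * cfNum α (k+1), ?_⟩
  have h := cf_det α k
  have : ((-1:ℤ)^k) * ((-1)^k) = 1 := by rw [← mul_pow]; simp
  calc _ = (-1:ℤ)^k * (cfDen α k * cfNum α (k+1) - cfDen α (k+1) * cfNum α k) := by ring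
    _ = 1 := by rw [h, this]

theorem sum_perm (G : ℤ → ℝ) (q : ℕ) (hq : 0 < q) (p : ℤ) (hpq : IsCoprime p (q : ℤ))
    (hG : ∀ i, G (i + q) = G i) :
    ∑ j ∈ Finset.range q, G (j * p) = ∑ j ∈ Finset.range q, G j := by
  have hq' : (0:ℤ) < q := by exact_mod_cast hq
  have hmod : ∀ i, G i = G (i % q) := by
    intro i
    have h : Function.Periodic G (q:ℤ) := hG
    have := h.sub_zsmul_eq (x := i) (i / q)
    rw [Int.emod_def, ← this]; simp [mul_comm]
  set σ : ℕ → ℕ := fun j => ((j * p) % q).toNat with hσ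
  have hσc : ∀ j : ℕ, ((σ j : ℕ) : ℤ) = (j * p) % q := fun j =>
    Int.toNat_of_nonneg (Int.emod_nonneg _ hq'.ne')
  have hmaps : Set.MapsTo σ (Finset.range q) (Finset.range q) := by
    intro j _
    have := Int.emod_lt_of_pos (j * p) hq'
    rw [← hσc] at this
    simpa using (by exact_mod_cast this : σ j < q)
  have hinj : Set.InjOn σ (Finset.range q) := by
    intro i hi j hj hij
    have h1 : ((i * p) % q : ℤ) = (j * p) % q := by rw [← hσc, ← hσc, hij]
    have h2 : (q:ℤ) ∣ (j * p - i * p) := Int.ModEq.dvd h1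
    rw [← sub_mul] at h2
    have h3 : (q:ℤ) ∣ (j - i : ℤ) := hpq.symm.dvd_of_dvd_mul_right h2
    have h4 : (i:ℤ) ≡ j [ZMOD q] := (Int.modEq_iff_dvd).2 h3
    have h5 : i ≡ j [MOD q] := (Int.natCast_modEq_iff).1 h4
    simp only [Finset.coe_range, Set.mem_Iio] at hi hj
    exact Nat.ModEq.eq_of_lt_of_lt h5 hi hj
  have hsurj : Set.SurjOn σ (Finset.range q) (Finset.range q) :=
    Finset.surjOn_of_injOn_of_card_le σ hmaps hinj le_rfl
  refine Finset.sum_nbij σ hmaps hinj hsurj ?_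
  intro j _
  rw [hσc]; exact hmod _

/-- The Denjoy and Koksma inequality. -/
theorem denjoy_koksma (u W : ℝ → ℝ) (c : ℝ)
    (hdom : ∀ y z, y ≤ z → |u y - u z| ≤ W z - W y) (hW : ∀ y, W (y + 1) = W y + c)
    (hu : Function.Periodic u 1) (hintg : ∀ a b, IntervalIntegrable u volume a b)
    (γ : ℝ) (p : ℤ) (q : ℕ) (hq : 0 < q) (hpq : IsCoprime p (q : ℤ))
    (happ : |q * γ - p| ≤ 1 / q) (x : ℝ) :
    ∑ j ∈ Finset.range q, u (x + j * γ) ≤ q * (∫ y in (0:ℝ)..1, u y) + 2 * c := by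
  have hq' : (0:ℝ) < q := by exact_mod_cast hq
  have hmono : ∀ y z, y ≤ z → W y ≤ W z := fun y z h => by
    linarith [hdom y z h, abs_nonneg (u y - u z)]
  have hdom2 : ∀ lo hi y z, lo ≤ y → y ≤ hi → lo ≤ z → z ≤ hi → u y ≤ u z + (W hi - W lo) := by
    intro lo hi y z h1 h2 h3 h4
    have a1 := hmono _ _ h1
    have a2 := hmono _ _ h2
    have a3 := hmono _ _ h3
    have a4 := hmono _ _ h4
    rcases le_total y z with h | h
    · have := le_abs_self (u y - u z); linarith [hdom y z h]
    · have := neg_abs_le (u z - u y); linarith [hdom z y h]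
  set G : ℤ → ℝ := fun i => W (x + (i + 1) / q) - W (x + (i - 1) / q) with hGdef
  set H : ℤ → ℝ := fun i => ∫ y in (x + i / q)..(x + (i + 1) / q), u y with hHdef
  have hGp : ∀ i, G (i + q) = G i := by
    intro i
    simp only [hGdef]
    have e1 : x + (((i + q : ℤ) : ℝ) + 1) / q = x + ((i:ℝ) + 1) / q + 1 := by
      push_cast; field_simp; ring
    have e2 : x + (((i + q : ℤ) : ℝ) - 1) / q = x + ((i:ℝ) - 1) / q + 1 := by
      push_cast; field_simp; ring
    rw [e1, e2, hW, hW]; ring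
  have hHp : ∀ i, H (i + q) = H i := by
    intro i
    simp only [hHdef]
    have e1 : x + (((i + q : ℤ) : ℝ) + 1) / q = x + ((i:ℝ) + 1) / q + 1 := by
      push_cast; field_simp; ring
    have e2 : x + (((i + q : ℤ) : ℝ)) / q = x + ((i:ℝ)) / q + 1 := by
      push_cast; field_simp; ring
    rw [e1, e2, ← intervalIntegral.integral_comp_add_right]
    congr 1
    funext y; exact hu y
  have hstep : ∀ j ∈ Finset.range q, u (x + j * γ) ≤ q * H (j * p) + G (j * p) := by
    intro j hj
    have hjq : (j:ℝ) ≤ q := by exact_mod_cast (Finset.mem_range.1 hj).le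
    set z : ℝ := x + (j * p : ℤ) / q with hz
    have hzd : |x + j * γ - z| ≤ 1 / q := by
      have : x + j * γ - z = (j / q) * (q * γ - p) := by
        rw [hz]; push_cast; field_simp; ring
      rw [this, abs_mul, abs_of_nonneg (by positivity)]
      calc (j / q : ℝ) * |q * γ - p| ≤ 1 * (1 / q) := by
            gcongr
            rw [div_le_one hq']; exact hjq
        _ = 1 / q := one_mul _
    rw [abs_le] at hzd
    have hG1 : G (j * p) = W (z + 1 / q) - W (z - 1 / q) := by
      simp only [hGdef, hz]
      congr 2 <;> ring
    have hH1 : H (j * p) = ∫ y in z..(z + 1 / q), u y := by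
      simp only [hHdef, hz]
      congr 1; ring
    have hq1 : (0:ℝ) < 1 / q := by positivity
    have hle : z ≤ z + 1 / q := by linarith
    have hI : ∫ y in z..(z + 1 / q), (u (x + j * γ) - G (j * p)) ≤ ∫ y in z..(z + 1 / q), u y := by
      apply intervalIntegral.integral_mono_on hle (by simp) (hintg _ _)
      intro y hy
      have := hdom2 (z - 1 / q) (z + 1 / q) (x + j * γ) y (by linarith) (by linarith)
        (by linarith [hy.1]) hy.2
      rw [hG1]; linarith
    rw [intervalIntegral.integral_const, ← hH1, smul_eq_mul] at hI
    have : (q:ℝ) * ((z + 1 / q - z) * (u (x + j * γ) - G (j * p))) ≤ q * H (j * p) :=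
      mul_le_mul_of_nonneg_left hI hq'.le
    have e : (q:ℝ) * ((z + 1 / q - z) * (u (x + j * γ) - G (j * p))) =
        u (x + j * γ) - G (j * p) := by field_simp; ring
    linarith
  have hsum := Finset.sum_le_sum hstep
  rw [Finset.sum_add_distrib, ← Finset.mul_sum, sum_perm H q hq p hpq hHp,
    sum_perm G q hq p hpq hGp] at hsum
  have hHs : ∑ j ∈ Finset.range q, H j = ∫ y in (0:ℝ)..1, u y := by
    have := intervalIntegral.sum_integral_adjacent_intervals (f := u) (μ := volume)
      (a := fun k : ℕ => x + (k:ℝ) / q) (n := q) (fun k _ => hintg _ _)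
    have e : ∀ j : ℕ, H j = ∫ y in (x + (j:ℝ) / q)..(x + ((j + 1 : ℕ) : ℝ) / q), u y := by
      intro j; simp only [hHdef]; push_cast; rfl
    simp only [e]
    rw [this, div_self hq'.ne']
    have := hu.intervalIntegral_add_eq x 0
    simpa using this
  have hGs : ∑ j ∈ Finset.range q, G j = 2 * c := by
    have e : ∀ j : ℕ, G j = (W (x + ((j + 1 : ℕ) : ℝ) / q) + W (x + (((j + 1 : ℕ) : ℝ) - 1) / q))
      - (W (x + (j : ℝ) / q) + W (x + ((j : ℝ) - 1) / q)) := by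
      intro j; simp only [hGdef]; push_cast; ring_nf
    simp only [e]
    rw [Finset.sum_range_sub (fun j : ℕ => W (x + (j : ℝ) / q) + W (x + ((j : ℝ) - 1) / q))]
    have e1 : x + (q:ℝ) / q = x + ((0:ℕ):ℝ) / q + 1 := by simp [hq'.ne']
    have e2 : x + ((q:ℝ) - 1) / q = x + (((0:ℕ):ℝ) - 1) / q + 1 := by
      push_cast; field_simp; ring
    rw [e1, e2, hW, hW]; ring
  rw [hHs, hGs] at hsum
  exact hsum

/-- One-step matrix. -/
def stepM (f : ℝ → ℝ) (E : ℝ) (y : ℝ) : Matrix (Fin 2) (Fin 2) ℂ :=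
  !![((E : ℂ) - (f y : ℂ)), -1; 1, 0]

theorem sch_zero (α : ℝ) (f : ℝ → ℝ) (E x : ℝ) : schCocycle α f E 0 x = 1 := by
  simp [schCocycle]

theorem sch_succ (α : ℝ) (f : ℝ → ℝ) (E : ℝ) (n : ℕ) (x : ℝ) :
    schCocycle α f E (n + 1) x = stepM f E (x + n * α) * schCocycle α f E n x := by
  unfold schCocycle
  rw [List.range_succ_eq_map, List.map_cons, List.prod_cons, List.map_map]
  congr 1
  congr 1
  apply List.map_congr_left
  intro k _
  have : n + 1 - 1 - Nat.succ k = n - 1 - k := by omega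
  simp only [Function.comp, this]

theorem sch_add (α : ℝ) (f : ℝ → ℝ) (E : ℝ) (m n : ℕ) (x : ℝ) :
    schCocycle α f E (m + n) x = schCocycle α f E m (x + n * α) * schCocycle α f E n x := by
  induction m with
  | zero => simp [sch_zero]
  | succ m ih =>
    rw [show m + 1 + n = (m + n) + 1 by ring, sch_succ, sch_succ, ih, mul_assoc]
    congr 2
    push_cast; ring

theorem sch_one (α : ℝ) (f : ℝ → ℝ) (E x : ℝ) : schCocycle α f E 1 x = stepM f E x := by
  simpa [sch_zero] using sch_succ α f E 0 x

theorem sch_succ' (α : ℝ) (f : ℝ → ℝ) (E : ℝ) (n : ℕ) (x : ℝ) :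
    schCocycle α f E (n + 1) x = schCocycle α f E n (x + α) * stepM f E x := by
  rw [sch_add, sch_one]; simp

theorem sch_det (α : ℝ) (f : ℝ → ℝ) (E : ℝ) (n : ℕ) (x : ℝ) :
    (schCocycle α f E n x).det = 1 := by
  induction n with
  | zero => simp [sch_zero]
  | succ n ih => rw [sch_succ, Matrix.det_mul, ih]; simp [stepM]

theorem sch_periodic (α : ℝ) (f : ℝ → ℝ) (hper : Function.Periodic f 1) (E : ℝ) (n : ℕ) :
    Function.Periodic (schCocycle α f E n) 1 := by
  intro x
  induction n with
  | zero => simp [sch_zero]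
  | succ n ih =>
    rw [sch_succ, sch_succ, ih]
    simp only [stepM]
    rw [show x + 1 + n * α = (x + n * α) + 1 by ring, hper]

theorem norm_row (A : Matrix (Fin 2) (Fin 2) ℂ) (i : Fin 2) : ‖A i 0‖ + ‖A i 1‖ ≤ ‖A‖ := by
  have h : ((∑ j, ‖A i j‖₊ : ℝ≥0) : ℝ) ≤ ‖A‖ := by
    rw [Matrix.linfty_opNorm_def]
    exact_mod_cast Finset.le_sup (f := fun i => ∑ j, ‖A i j‖₊) (Finset.mem_univ i)
  simpa [Fin.sum_univ_two] using h

theorem norm_le_of_row (A : Matrix (Fin 2) (Fin 2) ℂ) (r : ℝ) (hr : 0 ≤ r)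
    (h : ∀ i, ‖A i 0‖ + ‖A i 1‖ ≤ r) : ‖A‖ ≤ r := by
  lift r to ℝ≥0 using hr
  rw [Matrix.linfty_opNorm_def]
  norm_cast
  apply Finset.sup_le
  intro i _
  have := h i
  rw [Fin.sum_univ_two]
  exact_mod_cast this

theorem norm_entry (A : Matrix (Fin 2) (Fin 2) ℂ) (i j : Fin 2) : ‖A i j‖ ≤ ‖A‖ := by
  have := norm_row A i
  have h0 := norm_nonneg (A i 0)
  have h1 := norm_nonneg (A i 1)
  fin_cases j <;> simp only [Fin.zero_eta, Fin.mk_one] <;> linarith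

theorem one_le_norm_of_det (A : Matrix (Fin 2) (Fin 2) ℂ) (h : A.det = 1) : 1 ≤ ‖A‖ := by
  rw [Matrix.det_fin_two] at h
  have h0 := norm_row A 0
  have h1 := norm_row A 1
  have h2 : (1:ℝ) ≤ ‖A 0 0‖ * ‖A 1 1‖ + ‖A 0 1‖ * ‖A 1 0‖ := by
    rw [← norm_mul, ← norm_mul, ← norm_one (α := ℂ), ← h]
    exact norm_sub_le _ _
  have p00 := norm_nonneg (A 0 0)
  have p01 := norm_nonneg (A 0 1)
  have p10 := norm_nonneg (A 1 0)
  have p11 := norm_nonneg (A 1 1)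
  have h3 : (‖A 0 0‖ + ‖A 0 1‖) * (‖A 1 0‖ + ‖A 1 1‖) ≤ ‖A‖ * ‖A‖ := by gcongr
  nlinarith [mul_nonneg p00 p10, mul_nonneg p01 p11, norm_nonneg A]

theorem norm_stepM_le (f : ℝ → ℝ) (E y F : ℝ) (hF : |f y| ≤ F) : ‖stepM f E y‖ ≤ |E| + F + 1 := by
  have := abs_nonneg (f y)
  have hE := abs_nonneg E
  apply norm_le_of_row _ _ (by linarith)
  intro i
  have h1 : ‖(E:ℂ) - (f y : ℂ)‖ ≤ |E| + |f y| := by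
    refine (norm_sub_le _ _).trans ?_
    simp
  fin_cases i <;> simp [stepM] <;> linarith

theorem norm_stepM_sub (f : ℝ → ℝ) (E y z : ℝ) : ‖stepM f E y - stepM f E z‖ ≤ |f y - f z| := by
  apply norm_le_of_row _ _ (abs_nonneg _)
  intro i
  fin_cases i
  · simp only [stepM, Fin.zero_eta]
    have : (E:ℂ) - f y - (E - f z) = ((f z - f y : ℝ) : ℂ) := by push_cast; ring
    simp [this, -Complex.ofReal_sub, abs_sub_comm]
  · simp [stepM]

/-- Telescoping estimate. -/
theorem sch_tele (α : ℝ) (f : ℝ → ℝ) (E K ρ : ℝ) (hρ : 1 ≤ ρ)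
    (hb : ∀ n x, ‖schCocycle α f E n x‖ ≤ K * ρ ^ n) (y z : ℝ) (n m : ℕ) :
    ‖schCocycle α f E m (y + n * α) * (schCocycle α f E n y - schCocycle α f E n z)‖ ≤
      K ^ 2 * ρ ^ (m + n) * ∑ j ∈ Finset.range n, |f (y + j * α) - f (z + j * α)| := by
  induction n generalizing m with
  | zero => simp [sch_zero]
  | succ n ih =>
    have hK : 0 ≤ K := by
      have := hb 0 0
      have h2 := norm_nonneg (schCocycle α f E 0 0)
      simp only [pow_zero, mul_one] at this
      linarith
    have e1 : schCocycle α f E m (y + (n+1 : ℕ) * α) *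
        (schCocycle α f E (n+1) y - schCocycle α f E (n+1) z) =
        schCocycle α f E (m+1) (y + n * α) * (schCocycle α f E n y - schCocycle α f E n z) +
        schCocycle α f E m (y + (n+1 : ℕ) * α) * (stepM f E (y + n * α) - stepM f E (z + n * α))
          * schCocycle α f E n z := by
      rw [sch_succ' α f E m, sch_succ, sch_succ,
        show y + n * α + α = y + (n+1 : ℕ) * α by push_cast; ring]
      noncomm_ring
    rw [e1, Finset.sum_range_succ, mul_add]
    refine (norm_add_le _ _).trans (add_le_add ?_ ?_)
    · have := ih (m+1)
      rwa [show m + 1 + n = m + (n + 1) by ring] at this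
    · refine (norm_mul_le _ _).trans ?_
      have a1 := hb m (y + (n+1 : ℕ) * α)
      have a2 := hb n z
      have a3 := norm_stepM_sub f E (y + n * α) (z + n * α)
      calc _ ≤ (K * ρ ^ m * |f (y + n * α) - f (z + n * α)|) * (K * ρ ^ n) := by
            gcongr
            exact (norm_mul_le _ _).trans (by gcongr)
        _ = K ^ 2 * ρ ^ (m + n) * |f (y + n * α) - f (z + n * α)| := by ring
        _ ≤ _ := by
            gcongr
            omega

theorem f_bound (f V : ℝ → ℝ) (c : ℝ) (hper : Function.Periodic f 1)
    (hdom : ∀ y z, y ≤ z → |f y - f z| ≤ V z - V y) (hV : ∀ y, V (y + 1) = V y + c) (y : ℝ) :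
    |f y| ≤ |f 0| + c := by
  have hfr : f y = f (Int.fract y) := by
    have := hper.sub_zsmul_eq (x := y) ⌊y⌋
    rw [Int.fract]; simpa using this.symm
  have h1 := hdom 0 (Int.fract y) (Int.fract_nonneg y)
  have h2 := hdom (Int.fract y) 1 (Int.fract_lt_one y).le
  have h3 := hV 0
  rw [zero_add] at h3
  have h4 := abs_nonneg (f (Int.fract y) - f 1)
  have h5 := abs_sub_abs_le_abs_sub (f (Int.fract y)) (f 0)
  rw [abs_sub_comm] at h5
  rw [hfr]; linarith

theorem norm_one_le : ‖(1 : Matrix (Fin 2) (Fin 2) ℂ)‖ ≤ 1 := by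
  apply norm_le_of_row _ _ (by simp)
  intro i
  have h : i = 0 ∨ i = 1 := by omega
  rcases h with rfl | rfl <;> simp

theorem sch_crude (α : ℝ) (f : ℝ → ℝ) (E M : ℝ) (hM : ∀ y, ‖stepM f E y‖ ≤ M) (n : ℕ) (x : ℝ) :
    ‖schCocycle α f E n x‖ ≤ 1 * M ^ n := by
  have hM0 : 0 ≤ M := (norm_nonneg _).trans (hM 0)
  induction n with
  | zero =>
    rw [sch_zero, pow_zero, one_mul]
    exact norm_one_le
  | succ n ih =>
    rw [sch_succ]
    refine (norm_mul_le _ _).trans ?_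
    calc _ ≤ M * (1 * M ^ n) := by gcongr; exact hM _
      _ = _ := by ring

theorem abs_log_sub_le {a b : ℝ} (ha : 1 ≤ a) (hb : 1 ≤ b) :
    |Real.log a - Real.log b| ≤ |a - b| := by
  have key : ∀ {a b : ℝ}, 1 ≤ a → 1 ≤ b → Real.log a - Real.log b ≤ |a - b| := by
    intro a b ha hb
    have hb0 : 0 < b := by linarith
    have ha0 : 0 < a := by linarith
    rw [← Real.log_div ha0.ne' hb0.ne']
    have h1 := Real.log_le_sub_one_of_pos (div_pos ha0 hb0)
    have h2 : a / b - 1 = (a - b) / b := by field_simp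
    rw [h2] at h1
    refine h1.trans ?_
    rw [div_le_iff₀ hb0]
    nlinarith [le_abs_self (a - b), abs_nonneg (a - b)]
  rw [abs_le]
  constructor
  · have := key hb ha
    rw [abs_sub_comm] at this; linarith
  · exact key ha hb

theorem sch_log_sum (α : ℝ) (f : ℝ → ℝ) (E : ℝ) (n q : ℕ) (x : ℝ) :
    Real.log ‖schCocycle α f E (n * q) x‖ ≤
      ∑ i ∈ Finset.range q, Real.log ‖schCocycle α f E n (x + i * (n * α))‖ := by
  have h1 : ∀ m y, 1 ≤ ‖schCocycle α f E m y‖ := fun m y => one_le_norm_of_det _ (sch_det _ _ _ _ _)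
  induction q with
  | zero =>
    simp only [mul_zero, sch_zero, Finset.range_zero, Finset.sum_empty]
    exact Real.log_nonpos (norm_nonneg _) norm_one_le
  | succ q ih =>
    rw [Finset.sum_range_succ, mul_add, mul_one, add_comm (n * q) n, sch_add]
    have p1 := h1 n (x + (n * q : ℕ) * α)
    have p2 := h1 (n * q) x
    calc _ ≤ Real.log (‖schCocycle α f E n (x + (n * q : ℕ) * α)‖ * ‖schCocycle α f E (n * q) x‖) := by
          apply Real.log_le_log _ (norm_mul_le _ _)
          rw [← sch_add]
          exact lt_of_lt_of_le one_pos (h1 _ _)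
      _ = Real.log ‖schCocycle α f E (n * q) x‖ + Real.log ‖schCocycle α f E n (x + (n * q : ℕ) * α)‖ := by
          rw [Real.log_mul (by positivity) (by positivity), add_comm]
      _ ≤ _ := by
          refine add_le_add ih (le_of_eq ?_)
          rw [show x + (n * q : ℕ) * α = x + q * (n * α) by push_cast; ring]

/-- Uniform upper bound on the transfer matrices by the Lyapunov exponent. -/
theorem unif_bound (α : ℝ) (hα : Irrational α) (f V : ℝ → ℝ) (c : ℝ)
    (hper : Function.Periodic f 1)
    (hdom : ∀ y z, y ≤ z → |f y - f z| ≤ V z - V y) (hV : ∀ y, V (y + 1) = V y + c)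
    (E l r : ℝ) (hlr : l < r) (hr : 0 ≤ r)
    (hL : Tendsto
      (fun n : ℕ => (1 / n : ℝ) * ∫ x in Set.Ico (0:ℝ) 1, Real.log ‖schCocycle α f E n x‖)
      atTop (nhds l)) :
    ∃ K : ℝ, ∀ n x, ‖schCocycle α f E n x‖ ≤ K * (Real.exp r) ^ n := by
  have hdet : ∀ m y, 1 ≤ ‖schCocycle α f E m y‖ := fun m y =>
    one_le_norm_of_det _ (sch_det _ _ _ _ _)
  set M : ℝ := |E| + (|f 0| + c) + 1 with hMdef
  have hc0 : 0 ≤ |f 0| + c := (abs_nonneg _).trans (f_bound f V c hper hdom hV 0)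
  have hM1 : 1 ≤ M := by have := abs_nonneg E; linarith
  have hstep : ∀ y, ‖stepM f E y‖ ≤ M := fun y =>
    norm_stepM_le f E y _ (f_bound f V c hper hdom hV y)
  have hcrude := sch_crude α f E M hstep
  -- choose n
  obtain ⟨n, hn1, hn⟩ : ∃ n : ℕ, 1 ≤ n ∧
      (1 / n : ℝ) * (∫ x in Set.Ico (0:ℝ) 1, Real.log ‖schCocycle α f E n x‖) < (l + r) / 2 := by
    have := (hL.eventually (gt_mem_nhds (show l < (l + r) / 2 by linarith))).and
      (eventually_ge_atTop 1)
    obtain ⟨n, h1, h2⟩ := this.exists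
    exact ⟨n, h2, h1⟩
  have hn0 : (0:ℝ) < n := by exact_mod_cast hn1
  set u : ℝ → ℝ := fun x => Real.log ‖schCocycle α f E n x‖ with hu
  set W : ℝ → ℝ := fun y => M ^ n * ∑ j ∈ Finset.range n, V (y + j * α) with hW
  have hudom : ∀ y z, y ≤ z → |u y - u z| ≤ W z - W y := by
    intro y z hyz
    have h1 := abs_log_sub_le (hdet n y) (hdet n z)
    have h2 := abs_norm_sub_norm_le (schCocycle α f E n y) (schCocycle α f E n z)
    have h3 := sch_tele α f E 1 M hM1 hcrude y z n 0
    rw [sch_zero, one_mul, one_pow, one_mul, zero_add] at h3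
    have h4 : ∑ j ∈ Finset.range n, |f (y + j * α) - f (z + j * α)| ≤
        ∑ j ∈ Finset.range n, (V (z + j * α) - V (y + j * α)) :=
      Finset.sum_le_sum fun j _ => hdom _ _ (by linarith)
    have h5 : M ^ n * ∑ j ∈ Finset.range n, |f (y + j * α) - f (z + j * α)| ≤
        M ^ n * ∑ j ∈ Finset.range n, (V (z + j * α) - V (y + j * α)) := by gcongr
    rw [Finset.sum_sub_distrib, mul_sub] at h5
    exact h1.trans (h2.trans (h3.trans h5))
  have hWp : ∀ y, W (y + 1) = W y + M ^ n * (n * c) := by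
    intro y
    simp only [hW]
    have : ∀ j : ℕ, V (y + 1 + j * α) = V (y + j * α) + c := by
      intro j; rw [← hV]; congr 1; ring
    simp only [this, Finset.sum_add_distrib]
    simp; ring
  have hup : Function.Periodic u 1 := by
    intro x; simp only [hu]; rw [sch_periodic α f hper E n]
  have hWm : Monotone W := fun y z h => by
    linarith [hudom y z h, abs_nonneg (u y - u z)]
  have hWum : Monotone (fun y => u y + W y) := fun y z h => by
    have := hudom y z h
    have h2 := le_abs_self (u y - u z)
    simp only; linarith
  have hintg : ∀ a b, IntervalIntegrable u volume a b := by
    intro a b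
    have := (hWum.intervalIntegrable (μ := volume) (a := a) (b := b)).sub
      (hWm.intervalIntegrable (μ := volume) (a := a) (b := b))
    convert this using 1
    funext y; simp
  set C : ℝ := M ^ n * (n * c) with hC
  have hαn : Irrational (n * α) := hα.natCast_mul (by omega)
  obtain ⟨k, hk⟩ := exists_nat_gt (2 * C / (n * ((r - l) / 2)))
  set q := cfDen (n * α) k with hqdef
  have hq1 : 1 ≤ q := one_le_cfDen _ hαn k
  have hq0 : (0:ℝ) < q := by exact_mod_cast hq1
  have hkq : (k:ℝ) ≤ q := by exact_mod_cast le_cfDen _ hαn k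
  have happ : |q * (n * α) - cfNum (n * α) k| ≤ 1 / q := by
    refine (cf_abs _ hαn k).trans ?_
    apply one_div_le_one_div_of_le hq0
    exact_mod_cast cfDen_mono _ hαn k
  have hDK := denjoy_koksma u W C hudom hWp hup hintg (n * α) (cfNum (n * α) k) q hq1
    (cf_coprime _ k) happ
  have hIeq : (∫ x in Set.Ico (0:ℝ) 1, Real.log ‖schCocycle α f E n x‖) = ∫ y in (0:ℝ)..1, u y := by
    rw [intervalIntegral.integral_of_le zero_le_one, integral_Ico_eq_integral_Ioo,
      integral_Ioc_eq_integral_Ioo]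
  rw [hIeq, one_div, inv_mul_lt_iff₀ hn0] at hn
  have hQ : ∀ x, ‖schCocycle α f E (n * q) x‖ ≤ Real.exp r ^ (n * q) := by
    intro x
    have h1 := (sch_log_sum α f E n q x).trans (hDK x)
    have h2 : 2 * C ≤ q * (n * ((r - l) / 2)) := by
      have hp : 0 < n * ((r - l) / 2) := by
        have : 0 < r - l := by linarith
        positivity
      rw [div_lt_iff₀ hp] at hk
      nlinarith
    have h3 : q * (∫ y in (0:ℝ)..1, u y) ≤ q * (n * ((l + r) / 2)) := by gcongr
    have h4 : Real.log ‖schCocycle α f E (n * q) x‖ ≤ ((n * q : ℕ) : ℝ) * r := by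
      push_cast; linarith
    rw [← Real.exp_nat_mul]
    exact (Real.log_le_iff_le_exp (lt_of_lt_of_le one_pos (hdet _ _))).1 h4
  set Q := n * q with hQdef
  have hQpos : 0 < Q := Nat.mul_pos hn1 hq1
  have he1 : 1 ≤ Real.exp r := Real.one_le_exp hr
  have hblock : ∀ a s x, ‖schCocycle α f E (Q * a + s) x‖ ≤ M ^ s * Real.exp r ^ (Q * a) := by
    intro a s x
    induction a with
    | zero => simpa using hcrude s x
    | succ a ih =>
      rw [show Q * (a + 1) + s = Q + (Q * a + s) by ring, sch_add]
      refine (norm_mul_le _ _).trans ?_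
      calc _ ≤ Real.exp r ^ Q * (M ^ s * Real.exp r ^ (Q * a)) := by gcongr; exact hQ _
        _ = _ := by ring
  refine ⟨M ^ Q, fun N x => ?_⟩
  have := hblock (N / Q) (N % Q) x
  rw [Nat.div_add_mod] at this
  refine this.trans ?_
  have i1 : N % Q ≤ Q := (Nat.mod_lt _ hQpos).le
  have i2 : Q * (N / Q) ≤ N := Nat.mul_div_le _ _
  gcongr

theorem int_diff (V : ℝ → ℝ) (c : ℝ) (hm : Monotone V) (hV : ∀ y, V (y + 1) = V y + c)
    (t d : ℝ) :
    ∫ x in (0:ℝ)..1, (V (x + t + d) - V (x + t)) = c * d := by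
  have hi : ∀ a b, IntervalIntegrable V volume a b := fun a b => hm.intervalIntegrable
  have hi1 : ∀ s, IntervalIntegrable (fun x => V (x + s)) volume 0 1 := fun s =>
    Monotone.intervalIntegrable (fun a b h => hm (by linarith))
  have e1 : ∫ x in (0:ℝ)..1, (V (x + t + d) - V (x + t)) =
      (∫ x in (0:ℝ)..1, V (x + (t + d))) - ∫ x in (0:ℝ)..1, V (x + t) := by
    rw [← intervalIntegral.integral_sub (hi1 _) (hi1 _)]
    simp only [add_assoc]
  rw [e1, intervalIntegral.integral_comp_add_right, intervalIntegral.integral_comp_add_right]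
  rw [intervalIntegral.integral_interval_sub_interval_comm (hi _ _) (hi _ _) (hi _ _)]
  have e2 : ∫ x in (1 + t)..(1 + (t + d)), V x = ∫ x in t..(t + d), V (x + 1) := by
    rw [intervalIntegral.integral_comp_add_right]; congr 1 <;> ring
  have e3 : ∫ x in t..(t + d), V (x + 1) = (∫ x in t..(t + d), V x) + c * d := by
    simp only [hV]
    rw [intervalIntegral.integral_add (hi _ _) (by simp)]
    simp; ring
  have e4 := intervalIntegral.integral_symm (f := V) (μ := volume) (1 + t) (1 + (t + d))
  have e5 := intervalIntegral.integral_symm (f := V) (μ := volume) t (t + d)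
  rw [zero_add, zero_add]
  linarith

theorem lint_diff (V : ℝ → ℝ) (c : ℝ) (hm : Monotone V) (hV : ∀ y, V (y + 1) = V y + c)
    (t d : ℝ) :
    ∫⁻ x in Set.Ico (0:ℝ) 1, ENNReal.ofReal |V (x + t + d) - V (x + t)| = ENNReal.ofReal (c * |d|) := by
  wlog hd : 0 ≤ d generalizing t d with H
  · have := H (t + d) (-d) (by linarith)
    rw [abs_neg] at this
    rw [← this]
    congr 1
    funext x
    rw [abs_sub_comm]
    congr 3 <;> congr 1 <;> ring
  · have hpos : ∀ x, 0 ≤ V (x + t + d) - V (x + t) := fun x => by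
      linarith [hm (show x + t ≤ x + t + d by linarith)]
    have hi1 : ∀ s, IntervalIntegrable (fun x => V (x + s)) volume 0 1 := fun s =>
      Monotone.intervalIntegrable (fun a b h => hm (by linarith))
    have hI : IntervalIntegrable (fun x => V (x + t + d) - V (x + t)) volume 0 1 := by
      have := (hi1 (t + d)).sub (hi1 t)
      simpa only [← add_assoc] using this
    have h2 := hI.1
    rw [abs_of_nonneg hd, ← int_diff V c hm hV t d, intervalIntegral.integral_of_le zero_le_one,
      ofReal_integral_eq_lintegral_ofReal h2 (Eventually.of_forall hpos), restrict_Ico_eq_restrict_Ioc]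
    simp only [abs_of_nonneg (hpos _)]

theorem ae_small (α : ℝ) (hα : Irrational α) (f V : ℝ → ℝ) (c : ℝ)
    (hper : Function.Periodic f 1)
    (hdom : ∀ y z, y ≤ z → |f y - f z| ≤ V z - V y) (hV : ∀ y, V (y + 1) = V y + c) :
    ∀ᵐ x ∂(volume.restrict (Set.Ico (0:ℝ) 1)), ∀ᶠ k in atTop,
      (∑ j ∈ Finset.range (cfDen α k), |f (x + cfDen α k * α + j * α) - f (x + j * α)|) ≤
        (cfDen α k : ℝ) ^ 3 / cfDen α (k+1) ∧
      (∑ j ∈ Finset.range (cfDen α k), |f (x - cfDen α k * α + j * α) - f (x + j * α)|) ≤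
        (cfDen α k : ℝ) ^ 3 / cfDen α (k+1) := by
  have hm : Monotone V := fun y z h => by
    linarith [hdom y z h, abs_nonneg (f y - f z)]
  have hc : 0 ≤ c := by
    have := hm (show (0:ℝ) ≤ 0 + 1 by norm_num)
    rw [hV] at this; linarith
  have habs : ∀ y z, |f y - f z| ≤ |V y - V z| := by
    intro y z
    rcases le_total y z with h | h
    · rw [abs_sub_comm (V y)]; exact (hdom y z h).trans (le_abs_self _)
    · rw [abs_sub_comm]; exact (hdom z y h).trans (le_abs_self _)
  set d : ℕ → ℝ := fun k => cfDen α k * α - cfNum α k with hd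
  have hmeas : ∀ s : ℝ, Measurable (fun x => V (x + s)) := fun s =>
    hm.measurable.comp (measurable_id.add_const s)
  have hterm : ∀ t e : ℝ, Measurable (fun x => ENNReal.ofReal |V (x + t + e) - V (x + t)|) := by
    intro t e
    have h1 := hmeas (t + e)
    have h2 := hmeas t
    simp only [← add_assoc] at h1
    exact (Measurable.sub h1 h2).abs.ennreal_ofReal
  set g : ℕ → ℝ → ℝ≥0∞ := fun k x =>
    ENNReal.ofReal (cfDen α (k+1) / (cfDen α k : ℝ) ^ 3) *
    ∑ j ∈ Finset.range (cfDen α k),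
      (ENNReal.ofReal |V (x + j * α + d k) - V (x + j * α)| +
       ENNReal.ofReal |V (x + j * α + -d k) - V (x + j * α)|) with hg
  have hterm2 : ∀ (k j : ℕ), Measurable (fun x =>
      ENNReal.ofReal |V (x + j * α + d k) - V (x + j * α)| +
       ENNReal.ofReal |V (x + j * α + -d k) - V (x + j * α)|) := fun k j =>
    (hterm _ _).add (hterm _ _)
  have hgm : ∀ k, Measurable (g k) := by
    intro k
    apply Measurable.const_mul
    apply Finset.measurable_fun_sum
    intro j _
    exact hterm2 k j
  have hgi : ∀ k, ∫⁻ x in Set.Ico (0:ℝ) 1, g k x ≤ ENNReal.ofReal (2 * c * (1 / (k:ℝ) ^ 2) + (if k = 0 then 2 * c else 0)) := by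
    intro k
    have hq1 : (1:ℝ) ≤ cfDen α k := by exact_mod_cast one_le_cfDen α hα k
    have hq2 : (1:ℝ) ≤ cfDen α (k+1) := by exact_mod_cast one_le_cfDen α hα (k+1)
    have hkq : (k:ℝ) ≤ cfDen α k := by exact_mod_cast le_cfDen α hα k
    simp only [hg]
    rw [lintegral_const_mul _ (Finset.measurable_fun_sum _ fun j _ => hterm2 k j),
      lintegral_finsetSum _ (fun j _ => hterm2 k j)]
    have : ∀ j : ℕ, ∫⁻ x in Set.Ico (0:ℝ) 1, (ENNReal.ofReal |V (x + j * α + d k) - V (x + j * α)| +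
       ENNReal.ofReal |V (x + j * α + -d k) - V (x + j * α)|) = ENNReal.ofReal (2 * (c * |d k|)) := by
      intro j
      rw [lintegral_add_left (hterm _ _), lint_diff V c hm hV, lint_diff V c hm hV, abs_neg,
        ← ENNReal.ofReal_add (by positivity) (by positivity), two_mul]
    simp only [this]
    rw [Finset.sum_const, Finset.card_range, nsmul_eq_mul, ← ENNReal.ofReal_natCast,
      ← ENNReal.ofReal_mul (by positivity), ← ENNReal.ofReal_mul (by positivity)]
    apply ENNReal.ofReal_le_ofReal
    have hdk : |d k| ≤ 1 / cfDen α (k+1) := cf_abs α hα k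
    calc _ ≤ (cfDen α (k+1) / (cfDen α k : ℝ) ^ 3) * (cfDen α k * (2 * (c * (1 / cfDen α (k+1))))) := by
          gcongr
      _ = 2 * c * (1 / (cfDen α k : ℝ) ^ 2) := by field_simp
      _ ≤ _ := by
          rcases Nat.eq_zero_or_pos k with h | h
          · subst h; simp [cfDen]
          · have hk : (0:ℝ) < k := by exact_mod_cast h
            rw [if_neg h.ne', add_zero]
            gcongr
  have hsum : ∑' k, ∫⁻ x in Set.Ico (0:ℝ) 1, g k x ≠ ⊤ := by
    refine ne_top_of_le_ne_top ?_ (ENNReal.tsum_le_tsum hgi)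
    apply Summable.tsum_ofReal_ne_top
    apply Summable.add
    · exact (Real.summable_one_div_nat_pow.2 (by norm_num)).mul_left _
    · exact (hasSum_ite_eq 0 (2 * c)).summable
  rw [← lintegral_tsum (fun k => (hgm k).aemeasurable)] at hsum
  have hae := ae_lt_top (Measurable.tsum hgm) hsum
  filter_upwards [hae] with x hx
  have ht := ENNReal.tendsto_atTop_zero_of_tsum_ne_top hx.ne
  have hev := ht.eventually (gt_mem_nhds (show (0:ℝ≥0∞) < 1 by simp))
  filter_upwards [hev] with k hk
  have hq1 : (1:ℝ) ≤ cfDen α k := by exact_mod_cast one_le_cfDen α hα k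
  have hq2 : (1:ℝ) ≤ cfDen α (k+1) := by exact_mod_cast one_le_cfDen α hα (k+1)
  have hS : cfDen α (k+1) / (cfDen α k : ℝ) ^ 3 * ∑ j ∈ Finset.range (cfDen α k),
      (|V (x + j * α + d k) - V (x + j * α)| + |V (x + j * α + -d k) - V (x + j * α)|) < 1 := by
    simp only [hg] at hk
    simp only [← ENNReal.ofReal_add (abs_nonneg _) (abs_nonneg _)] at hk
    rw [← ENNReal.ofReal_sum_of_nonneg (fun j _ => by positivity),
      ← ENNReal.ofReal_mul (by positivity), ENNReal.ofReal_lt_one] at hk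
    exact hk
  have hS2 : ∑ j ∈ Finset.range (cfDen α k),
      (|V (x + j * α + d k) - V (x + j * α)| + |V (x + j * α + -d k) - V (x + j * α)|) ≤
      (cfDen α k : ℝ) ^ 3 / cfDen α (k+1) := by
    rw [le_div_iff₀ (by positivity)]
    rw [div_mul_eq_mul_div, div_lt_one (by positivity)] at hS
    linarith
  have hintg : ∀ y : ℝ, ∀ p : ℤ, f (y + p) = f y := fun y p => by
    simpa using hper.int_mul p y
  constructor
  · refine (Finset.sum_le_sum fun j _ => ?_).trans hS2
    have : f (x + cfDen α k * α + j * α) = f (x + j * α + d k) := by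
      rw [← hintg (x + j * α + d k) (cfNum α k)]; congr 1; simp only [hd]; ring
    rw [this]
    refine (habs _ _).trans ?_
    linarith [abs_nonneg (V (x + j * α + -d k) - V (x + j * α))]
  · refine (Finset.sum_le_sum fun j _ => ?_).trans hS2
    have : f (x - cfDen α k * α + j * α) = f (x + j * α + -d k) := by
      rw [← hintg (x - cfDen α k * α + j * α) (cfNum α k)]; congr 1; simp only [hd]; ring
    rw [this]
    refine (habs _ _).trans ?_
    linarith [abs_nonneg (V (x + j * α + d k) - V (x + j * α))]

theorem norm_adj_le (X : Matrix (Fin 2) (Fin 2) ℂ) : ‖X.adjugate‖ ≤ 2 * ‖X‖ := by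
  apply norm_le_of_row _ _ (by positivity)
  intro i
  have h00 := norm_entry X 0 0
  have h01 := norm_entry X 0 1
  have h10 := norm_entry X 1 0
  have h11 := norm_entry X 1 1
  rw [Matrix.adjugate_fin_two]
  have h : i = 0 ∨ i = 1 := by omega
  rcases h with rfl | rfl <;> simp <;> linarith

theorem gordon_ineq (A A' B : Matrix (Fin 2) (Fin 2) ℂ) (hA : A.det = 1) (hB : B.det = 1)
    (v w : Fin 2 → ℂ) (hw : B.mulVec w = v) (η : ℝ) (h1 : ‖A' - A‖ ≤ η) (h2 : ‖B - A‖ ≤ η) :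
    ‖v‖ ≤ ‖A.mulVec v‖ + ‖w‖ + ‖A'.mulVec (A.mulVec v)‖ + 2 * η * (‖v‖ + ‖A.mulVec v‖) := by
  have hη : 0 ≤ η := (norm_nonneg _).trans h1
  have hadjB : B.adjugate.mulVec v = w := by
    rw [← hw, Matrix.mulVec_mulVec, Matrix.adjugate_mul, hB, one_smul, Matrix.one_mulVec]
  set t : ℂ := A 0 0 + A 1 1 with ht
  have htr : A + A.adjugate = t • (1 : Matrix (Fin 2) (Fin 2) ℂ) := by
    rw [Matrix.adjugate_fin_two]
    ext i j
    fin_cases i <;> fin_cases j <;> simp [ht, add_comm]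
  have hadd : A.adjugate = B.adjugate - (B - A).adjugate := by
    simp only [Matrix.adjugate_fin_two]
    ext i j
    fin_cases i <;> fin_cases j <;> simp <;> ring
  have n1 := norm_nonneg v
  have n2 := norm_nonneg (A.mulVec v)
  have n3 := norm_nonneg w
  have n4 := norm_nonneg (A'.mulVec (A.mulVec v))
  rcases le_total 1 ‖t‖ with h | h
  · have e : t • v = A.mulVec v + w - (B - A).adjugate.mulVec v := by
      have : (A + A.adjugate).mulVec v = t • v := by
        rw [htr, Matrix.smul_mulVec, Matrix.one_mulVec]
      rw [← this, hadd, Matrix.add_mulVec, Matrix.sub_mulVec, hadjB]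
      abel
    have e2 : ‖(B - A).adjugate.mulVec v‖ ≤ 2 * η * ‖v‖ := by
      refine (Matrix.linfty_opNorm_mulVec _ _).trans ?_
      gcongr
      exact (norm_adj_le _).trans (by gcongr)
    have e3 : ‖v‖ ≤ ‖t • v‖ := by
      rw [norm_smul]; nlinarith
    have e4 : ‖t • v‖ ≤ ‖A.mulVec v‖ + ‖w‖ + ‖(B - A).adjugate.mulVec v‖ := by
      rw [e]
      exact (norm_sub_le _ _).trans (add_le_add (norm_add_le _ _) le_rfl)
    have : 0 ≤ 2 * η * ‖A.mulVec v‖ := by positivity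
    linarith
  · have e : v = t • A.mulVec v - A'.mulVec (A.mulVec v) + (A' - A).mulVec (A.mulVec v) := by
      have h3 : (A + A.adjugate) * A = t • A := by rw [htr, smul_mul_assoc, one_mul]
      rw [add_mul, Matrix.adjugate_mul, hA, one_smul] at h3
      have h4 := congrArg (fun X => Matrix.mulVec X v) h3
      simp only [Matrix.add_mulVec, Matrix.one_mulVec, Matrix.smul_mulVec] at h4
      rw [← h4, Matrix.sub_mulVec, Matrix.mulVec_mulVec, Matrix.mulVec_mulVec]
      abel
    have e2 : ‖(A' - A).mulVec (A.mulVec v)‖ ≤ η * ‖A.mulVec v‖ := by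
      refine (Matrix.linfty_opNorm_mulVec _ _).trans ?_
      gcongr
    have e3 : ‖t • A.mulVec v‖ ≤ ‖A.mulVec v‖ := by
      rw [norm_smul]; nlinarith
    have e4 : ‖v‖ ≤ ‖t • A.mulVec v‖ + ‖A'.mulVec (A.mulVec v)‖ + ‖(A' - A).mulVec (A.mulVec v)‖ := by
      conv_lhs => rw [e]
      exact (norm_add_le _ _).trans (add_le_add (norm_sub_le _ _) le_rfl)
    have : 0 ≤ 2 * η * ‖v‖ := by positivity
    have : 0 ≤ η * ‖A.mulVec v‖ := by positivity
    linarith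

/-- The phase vector of a solution. -/
def solVec (ψ : ℤ → ℂ) (m : ℤ) : Fin 2 → ℂ := ![ψ m, ψ (m - 1)]

theorem solVec_step (α : ℝ) (f : ℝ → ℝ) (E x : ℝ) (ψ : ℤ → ℂ)
    (hψ : ∀ m : ℤ, ψ (m + 1) + ψ (m - 1) + (f (x + m * α) : ℂ) * ψ m = (E : ℂ) * ψ m)
    (m : ℤ) (n : ℕ) :
    (schCocycle α f E n (x + m * α)).mulVec (solVec ψ m) = solVec ψ (m + n) := by
  induction n with
  | zero => simp [sch_zero]
  | succ n ih =>
    rw [sch_succ, ← Matrix.mulVec_mulVec, ih]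
    have h := hψ (m + n)
    have e : x + m * α + n * α = x + ((m + n : ℤ) : ℝ) * α := by push_cast; ring
    rw [e]
    simp only [solVec, stepM]
    have e2 : m + ((n + 1 : ℕ) : ℤ) = m + n + 1 := by push_cast; ring
    rw [e2]
    ext i
    have h : i = 0 ∨ i = 1 := by omega
    rcases h with rfl | rfl
    · simp [Matrix.mulVec, dotProduct, Fin.sum_univ_two]
      have h' := hψ (m + n)
      push_cast at h'
      linear_combination -h'
    · simp [Matrix.mulVec, dotProduct, Fin.sum_univ_two]

theorem solVec_ne (α : ℝ) (f : ℝ → ℝ) (E x : ℝ) (ψ : ℤ → ℂ)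
    (hψ : ∀ m : ℤ, ψ (m + 1) + ψ (m - 1) + (f (x + m * α) : ℂ) * ψ m = (E : ℂ) * ψ m)
    (h0 : ψ ≠ 0) : solVec ψ 0 ≠ 0 := by
  intro h
  apply h0
  have hall : ∀ m, solVec ψ m = 0 := by
    intro m
    obtain ⟨n, rfl | rfl⟩ := m.eq_nat_or_neg
    · have := solVec_step α f E x ψ hψ 0 n
      rw [h, Matrix.mulVec_zero, zero_add] at this
      exact this.symm
    · have := solVec_step α f E x ψ hψ (-n) n
      rw [neg_add_cancel, h] at this
      have h2 := congrArg (Matrix.mulVec (Matrix.adjugate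
        (schCocycle α f E n (x + ((-(n:ℤ) : ℤ) : ℝ) * α)))) this
      rw [Matrix.mulVec_mulVec, Matrix.adjugate_mul, sch_det, one_smul, Matrix.one_mulVec,
        Matrix.mulVec_zero] at h2
      exact h2
  funext m
  have := congrFun (hall m) 0
  simpa [solVec] using this

theorem solVec_tendsto (ψ : ℤ → ℂ) (hs : Summable (fun m : ℤ => ‖ψ m‖ ^ 2)) :
    Tendsto (fun m => ‖solVec ψ m‖) cofinite (nhds 0) := by
  have h1 : Tendsto (fun m => ‖ψ m‖) cofinite (nhds 0) := by
    have := (hs.tendsto_cofinite_zero).sqrt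
    simpa [Real.sqrt_sq (norm_nonneg _)] using this
  have h2 : Tendsto (fun m : ℤ => ‖ψ (m - 1)‖) cofinite (nhds 0) :=
    h1.comp (sub_left_injective (b := (1:ℤ))).tendsto_cofinite
  refine squeeze_zero (fun _ => norm_nonneg _) (fun m => ?_) (by simpa using h1.add h2)
  rw [pi_norm_le_iff_of_nonneg (by positivity)]
  intro i
  have n1 := norm_nonneg (ψ m)
  have n2 := norm_nonneg (ψ (m - 1))
  have h : i = 0 ∨ i = 1 := by omega
  rcases h with rfl | rfl <;> simp [solVec]

theorem eta_tendsto (C s : ℝ) (hs : 0 < s) (q : ℕ → ℕ) (hq : Tendsto q atTop atTop) :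
    Tendsto (fun k => C * ((q k : ℝ) ^ 3 * Real.exp (-(s * q k)))) atTop (nhds 0) := by
  have h1 := Real.tendsto_pow_mul_exp_neg_atTop_nhds_zero 3
  have h2 : Tendsto (fun k => s * (q k : ℝ)) atTop atTop :=
    (tendsto_natCast_atTop_atTop.comp hq).const_mul_atTop hs
  have h3 := (h1.comp h2).const_mul (C / s ^ 3)
  rw [mul_zero] at h3
  refine h3.congr fun k => ?_
  simp only [Function.comp]
  field_simp
/-- (Sharp arithmetic Gordon theorem for potentials of bounded variation.)
Let `α` be irrational and `f : ℝ → ℝ` a `1`-periodic function with `Var f < ∞`, and let `L E`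
be the Lyapunov exponent of the Schrödinger cocycle. Then for a.e. `x ∈ [0,1)`, no `E` with
`0 < L(E) < β(α)` is an eigenvalue of `H(x)`. -/
theorem sharp_gordon_boundedVariation (α : ℝ) (hα : Irrational α) (f : ℝ → ℝ)
    (hper : Function.Periodic f 1) (hBV : pVar f ≠ ⊤)
    (L : ℝ → ℝ)
    (hL : ∀ E : ℝ, Tendsto
      (fun n : ℕ => (1 / n : ℝ) * ∫ x in Set.Ico (0:ℝ) 1, Real.log ‖schCocycle α f E n x‖)
      atTop (nhds (L E))) :
    ∀ᵐ x ∂(volume.restrict (Set.Ico (0:ℝ) 1)), ∀ E : ℝ,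
      0 < L E → ((L E : ℝ) : EReal) < cfBeta α →
      ¬ ∃ ψ : ℤ → ℂ, ψ ≠ 0 ∧ Summable (fun m : ℤ => ‖ψ m‖ ^ 2) ∧
        ∀ m : ℤ, ψ (m + 1) + ψ (m - 1) + (f (x + m * α) : ℂ) * ψ m = (E : ℂ) * ψ m := by
  obtain ⟨V, c, hdom, hV⟩ := exists_dom f hper hBV
  filter_upwards [ae_small α hα f V c hper hdom hV] with x hx E hLpos hLβ
  rintro ⟨ψ, hψ0, hψs, hψ⟩
  -- choose exponents
  obtain ⟨b, hb1, hb2⟩ := EReal.lt_iff_exists_real_btwn.1 hLβ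
  have hb1' : L E < b := by exact_mod_cast hb1
  have hfreq := frequently_lt_of_lt_limsup (by isBoundedDefault) hb2
  set r : ℝ := (L E + b) / 2 with hr
  have hLr : L E < r := by rw [hr]; linarith
  have hrb : r < b := by rw [hr]; linarith
  obtain ⟨K, hK⟩ := unif_bound α hα f V c hper hdom hV E (L E) r hLr (by linarith) (hL E)
  set q : ℕ → ℕ := cfDen α with hq
  have hqt : Tendsto q atTop atTop := tendsto_atTop_mono (le_cfDen α hα) tendsto_id
  set η : ℕ → ℝ := fun k => K ^ 2 * ((q k : ℝ) ^ 3 * Real.exp (-((b - r) * q k))) with hη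
  have hηt : Tendsto η atTop (nhds 0) := eta_tendsto (K ^ 2) (b - r) (by linarith) q hqt
  set Ψ := solVec ψ with hΨ
  have hΨt := solVec_tendsto ψ hψs
  have hsub : ∀ σ : ℕ → ℤ, Function.Injective σ → Tendsto (fun k => ‖Ψ (σ (q k))‖) atTop (nhds 0) := by
    intro σ hσ
    have h := hΨt.comp hσ.tendsto_cofinite
    rw [Nat.cofinite_eq_atTop] at h
    exact h.comp hqt
  have t1 := hsub (fun n => (n:ℤ)) (fun a b h => by simpa using h)
  have t2 := hsub (fun n => -(n:ℤ)) (fun a b h => by simpa using h)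
  have t3 := hsub (fun n => (n:ℤ) + n) (fun a b h => by simp only at h; omega)
  have hlim : Tendsto (fun k => ‖Ψ (q k)‖ + ‖Ψ (-(q k : ℤ))‖ + ‖Ψ ((q k : ℤ) + q k)‖ +
      2 * η k * (‖Ψ 0‖ + ‖Ψ (q k)‖)) atTop (nhds 0) := by
    have := ((t1.add t2).add t3).add ((hηt.const_mul 2).mul (t1.const_add ‖Ψ 0‖))
    simpa using this
  have hpos : 0 < ‖Ψ 0‖ := norm_pos_iff.2 (solVec_ne α f E x ψ hψ hψ0)
  have hev := hlim.eventually (gt_mem_nhds hpos)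
  obtain ⟨k, hkb, ⟨hk1, hk2⟩, hk3⟩ := (hfreq.and_eventually (hx.and hev)).exists
  have hkb' : b < Real.log (q (k+1)) / q k := by exact_mod_cast hkb
  have hq1 : (1:ℝ) ≤ q k := by exact_mod_cast one_le_cfDen α hα k
  have hq2 : (1:ℝ) ≤ q (k+1) := by exact_mod_cast one_le_cfDen α hα (k+1)
  rw [lt_div_iff₀ (by linarith), Real.lt_log_iff_exp_lt (by linarith)] at hkb'
  have hbound : K ^ 2 * (Real.exp r) ^ (0 + q k) * ((q k : ℝ) ^ 3 / q (k+1)) ≤ η k := by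
    have e : (Real.exp r) ^ (0 + q k) * Real.exp (-(b * q k)) = Real.exp (-((b - r) * q k)) := by
      rw [zero_add, ← Real.exp_nat_mul, ← Real.exp_add]; congr 1; ring
    simp only [hη]
    rw [← e, Real.exp_neg, div_eq_mul_inv]
    have : ((q (k+1) : ℝ))⁻¹ ≤ (Real.exp (b * q k))⁻¹ :=
      inv_anti₀ (Real.exp_pos _) hkb'.le
    calc _ ≤ K ^ 2 * (Real.exp r) ^ (0 + q k) * ((q k : ℝ) ^ 3 * (Real.exp (b * q k))⁻¹) := by gcongr
      _ = _ := by ring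
  have her : 1 ≤ Real.exp r := Real.one_le_exp (by linarith)
  have d1 : ‖schCocycle α f E (q k) (x + q k * α) - schCocycle α f E (q k) x‖ ≤ η k := by
    have := sch_tele α f E K (Real.exp r) her hK (x + q k * α) x (q k) 0
    rw [sch_zero, one_mul] at this
    refine this.trans (le_trans ?_ hbound)
    gcongr
  have d2 : ‖schCocycle α f E (q k) (x - q k * α) - schCocycle α f E (q k) x‖ ≤ η k := by
    have := sch_tele α f E K (Real.exp r) her hK (x - q k * α) x (q k) 0
    rw [sch_zero, one_mul] at this
    refine this.trans (le_trans ?_ hbound)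
    gcongr
  have s1 : (schCocycle α f E (q k) x).mulVec (Ψ 0) = Ψ (q k) := by
    simpa using solVec_step α f E x ψ hψ 0 (q k)
  have s2 : (schCocycle α f E (q k) (x + q k * α)).mulVec (Ψ (q k)) = Ψ ((q k : ℤ) + q k) := by
    simpa using solVec_step α f E x ψ hψ (q k) (q k)
  have s3 : (schCocycle α f E (q k) (x - q k * α)).mulVec (Ψ (-(q k : ℤ))) = Ψ 0 := by
    have := solVec_step α f E x ψ hψ (-(q k : ℤ)) (q k)
    rw [neg_add_cancel] at this
    have e : x + ((-(q k : ℤ) : ℤ) : ℝ) * α = x - q k * α := by push_cast; ring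
    rw [e] at this
    exact this
  have hG := gordon_ineq _ _ _ (sch_det α f E (q k) x) (sch_det α f E (q k) (x - q k * α))
    (Ψ 0) (Ψ (-(q k : ℤ))) s3 (η k) d1 d2
  rw [s1, s2] at hG
  linarith
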